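/- Noiseless error estimate for the first Newton step after a frequency increment: let X and Y be real Hilbert spaces and F : X × ℝ → Y twice continuously Fréchet differentiable with ‖∂_rF(r,k)‖ ≤ d₁, ‖∂_kF(r,k)‖ ≤ d₂, ‖∂²_{rr}F(r,k)‖ ≤ d₃ and ‖∂²_{kr}F(r,k)‖ ≤ d₄ for all (r,k). Let X' ⊆ X be a closed subspace with orthogonal projection P; let k ≤ k' be reals with Δk := k' − k; let r̃, r̃' ∈ X' satisfy F(r̃, k) = 0, F(r̃', k') = 0 and ‖r̃' − r̃‖ ≤ d₀Δk for some d₀ > 0; let σ ≥ 0 satisfy ‖∂_rF(r̃, k)x‖ ≥ σ‖x‖ for all x ∈ X; let α > 0, let r ∈ X', and define r⁺ := r − P R_α(∂_rF(r, k')) F(r, k'). Then ‖r̃' − r⁺‖ ≤ Δk (d₀ + d₂/(2√α)) + (α/(α + σ²)) ‖r̃ − r‖ + (9d₁d₄/(4α)) Δk ‖r̃ − r‖ + (9d₁d₃/(4α) + d₃/(4√α)) ‖r̃ − r‖². -/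

import Mathlib

lemma aux_taylor {X Y : Type*}
    [NormedAddCommGroup X] [NormedSpace ℝ X]
    [NormedAddCommGroup Y] [NormedSpace ℝ Y]
    (f : X → Y) (hf : ContDiff ℝ 2 f) (d : ℝ)
    (hd : ∀ x, ‖fderiv ℝ (fun x' => fderiv ℝ f x') x‖ ≤ d) (r e : X) :
    ‖f (r + e) - f r - fderiv ℝ f r e‖ ≤ d / 2 * ‖e‖ ^ 2 := by
  have hd1 : Differentiable ℝ f := hf.differentiable (by norm_num)
  have hd2 : Differentiable ℝ (fun x' => fderiv ℝ f x') :=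
    (hf.fderiv_right (m := 1) (by norm_num)).differentiable (by norm_num)
  have hlip : ∀ x y, ‖fderiv ℝ f y - fderiv ℝ f x‖ ≤ d * ‖y - x‖ := fun x y =>
    Convex.norm_image_sub_le_of_norm_fderiv_le (𝕜 := ℝ) (s := Set.univ)
      (fun x _ => hd2 x) (fun x _ => hd x) convex_univ trivial trivial
  have hg : ∀ t : ℝ, HasDerivAt (fun t : ℝ => f (r + t • e) - f r - t • fderiv ℝ f r e)
      (fderiv ℝ f (r + t • e) e - fderiv ℝ f r e) t := by
    intro t
    have h1 : HasDerivAt (fun t : ℝ => r + t • e) e t := by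
      simpa using ((hasDerivAt_id t).smul_const e).const_add r
    have h2 := (hd1 (r + t • e)).hasFDerivAt.comp_hasDerivAt t h1
    have h3 : HasDerivAt (fun t : ℝ => t • fderiv ℝ f r e) (fderiv ℝ f r e) t := by
      simpa using (hasDerivAt_id t).smul_const (fderiv ℝ f r e)
    exact (h2.sub_const (f r)).sub h3
  have hB : ∀ t : ℝ, HasDerivAt (fun t : ℝ => d / 2 * ‖e‖ ^ 2 * t ^ 2) (d * ‖e‖ ^ 2 * t) t := by
    intro t
    have := (hasDerivAt_pow 2 t).const_mul (d / 2 * ‖e‖ ^ 2)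
    refine this.congr_deriv ?_
    push_cast
    ring
  have key := image_norm_le_of_norm_deriv_right_le_deriv_boundary
    (f := fun t : ℝ => f (r + t • e) - f r - t • fderiv ℝ f r e) (a := 0) (b := 1)
    (fun t _ => (hg t).continuousAt.continuousWithinAt)
    (fun t _ => (hg t).hasDerivWithinAt)
    (B := fun t : ℝ => d / 2 * ‖e‖ ^ 2 * t ^ 2) (by simp)
    hB
    (by
      intro t ht
      rw [← sub_apply]
      refine (ContinuousLinearMap.le_opNorm _ _).trans ?_
      have h := hlip r (r + t • e)
      rw [add_sub_cancel_left, norm_smul, Real.norm_of_nonneg ht.1] at h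
      have := mul_le_mul_of_nonneg_right h (norm_nonneg e)
      linarith)
  have := key (x := 1) (by simp)
  simpa using this

lemma aux_reg {X Y : Type*}
    [NormedAddCommGroup X] [InnerProductSpace ℝ X] [CompleteSpace X]
    [NormedAddCommGroup Y] [InnerProductSpace ℝ Y] [CompleteSpace Y]
    (A : X →L[ℝ] Y) (α : ℝ) (hα : 0 < α) (w : X) (y : Y)
    (h : α • w + ContinuousLinearMap.adjoint A (A w) = ContinuousLinearMap.adjoint A y) :
    ‖w‖ ≤ ‖y‖ / (2 * Real.sqrt α) := by
  have h1 := congrArg (fun z => inner ℝ z w) h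
  simp only [inner_add_left, inner_smul_left, ContinuousLinearMap.adjoint_inner_left,
    real_inner_self_eq_norm_sq] at h1
  have h2 := real_inner_le_norm y (A w)
  have h0 := Real.sqrt_pos.2 hα
  have hs := Real.sq_sqrt hα.le
  rw [le_div_iff₀ (by positivity)]
  refine abs_le_of_sq_le_sq' ?_ (norm_nonneg y) |>.2
  simp at h1
  have : (‖w‖ * (2 * √α)) ^ 2 = 4 * (α * ‖w‖ ^ 2) := by rw [← hs]; simp; ring
  rw [this]
  nlinarith [sq_nonneg (‖y‖ - 2 * ‖A w‖)]

lemma aux_main {X Y : Type*}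
    [NormedAddCommGroup X] [InnerProductSpace ℝ X] [CompleteSpace X]
    [NormedAddCommGroup Y] [InnerProductSpace ℝ Y] [CompleteSpace Y]
    (A A0 : X →L[ℝ] Y) (α : ℝ) (hα : 0 < α) (u e : X) (d δ σ : ℝ) (hσ : 0 ≤ σ)
    (hd : 0 < d)
    (hA : ‖A‖ ≤ d) (hA0 : ‖A0‖ ≤ d) (hδ : ‖A - A0‖ ≤ δ)
    (hlow : ∀ x, σ * ‖x‖ ≤ ‖A0 x‖)
    (h : α • u + ContinuousLinearMap.adjoint A (A u) = α • e) :
    ‖u‖ ≤ α / (α + σ ^ 2) * ‖e‖ + 9 * d / (4 * α) * δ * ‖e‖ := by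
  have hδ0 : 0 ≤ δ := (norm_nonneg _).trans hδ
  have h1 := congrArg (fun z => inner ℝ z u) h
  simp only [inner_add_left, inner_smul_left, ContinuousLinearMap.adjoint_inner_left,
    real_inner_self_eq_norm_sq] at h1
  simp at h1
  have h2 := real_inner_le_norm e u
  have hrhs : 0 ≤ α / (α + σ ^ 2) * ‖e‖ + 9 * d / (4 * α) * δ * ‖e‖ := by positivity
  rcases (norm_nonneg u).eq_or_lt with hu | hu
  · rw [← hu]; exact hrhs
  have hue : ‖u‖ ≤ ‖e‖ := by
    have : α * ‖u‖ * ‖u‖ ≤ α * ‖e‖ * ‖u‖ := by nlinarith [sq_nonneg ‖A u‖]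
    exact le_of_mul_le_mul_left (le_of_mul_le_mul_right this hu) hα
  have hAu := (A.le_opNorm u).trans (mul_le_mul_of_nonneg_right hA hu.le)
  have hA0u := (A0.le_opNorm u).trans (mul_le_mul_of_nonneg_right hA0 hu.le)
  have hdu : ‖A0 u‖ - ‖A u‖ ≤ δ * ‖u‖ := by
    have h3 := ((A - A0).le_opNorm u).trans (mul_le_mul_of_nonneg_right hδ hu.le)
    have h4 := norm_sub_norm_le (A0 u) (A u)
    rw [norm_sub_rev, ← sub_apply] at h4
    exact h4.trans h3
  have hsq : ‖A0 u‖ ^ 2 - ‖A u‖ ^ 2 ≤ 2 * d * δ * ‖u‖ * ‖u‖ := by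
    have h5 : (‖A0 u‖ - ‖A u‖) * (‖A0 u‖ + ‖A u‖) ≤ δ * ‖u‖ * (‖A0 u‖ + ‖A u‖) :=
      mul_le_mul_of_nonneg_right hdu (by positivity)
    have h6 : δ * ‖u‖ * (‖A0 u‖ + ‖A u‖) ≤ δ * ‖u‖ * (2 * (d * ‖u‖)) :=
      mul_le_mul_of_nonneg_left (by linarith) (by positivity)
    nlinarith
  have hl : (σ * ‖u‖) ^ 2 ≤ ‖A0 u‖ ^ 2 := pow_le_pow_left₀ (by positivity) (hlow u) 2
  have h7 : (α + σ ^ 2) * ‖u‖ * ‖u‖ ≤ (α * ‖e‖ + 2 * d * δ * ‖u‖) * ‖u‖ := by nlinarith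
  have h8 := le_of_mul_le_mul_right h7 hu
  have h9 : (α + σ ^ 2) * ‖u‖ ≤ α * ‖e‖ + 2 * d * δ * ‖e‖ :=
    h8.trans (by gcongr)
  have hp : 0 < α + σ ^ 2 := by positivity
  have h10 : ‖u‖ ≤ α / (α + σ ^ 2) * ‖e‖ + 2 * d * δ * ‖e‖ / (α + σ ^ 2) := by
    rw [div_mul_eq_mul_div, ← add_div, le_div_iff₀ hp]; linarith
  refine h10.trans ?_
  gcongr
  calc 2 * d * δ * ‖e‖ / (α + σ ^ 2) ≤ 2 * d * δ * ‖e‖ / α := by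
        gcongr; nlinarith [sq_nonneg σ]
    _ ≤ (9 / 4) * d * δ * ‖e‖ / α := by gcongr; norm_num
    _ = _ := by field_simp

/-- Noiseless error estimate for the first projected Newton step after a frequency
increment. -/
theorem stmt_12 {X Y : Type*}
    [NormedAddCommGroup X] [InnerProductSpace ℝ X] [CompleteSpace X]
    [NormedAddCommGroup Y] [InnerProductSpace ℝ Y] [CompleteSpace Y]
    (F : X × ℝ → Y) (hF : ContDiff ℝ 2 F)
    (d₀ d₁ d₂ d₃ d₄ : ℝ) (hd₀ : 0 < d₀) (hd₁ : 0 < d₁) (hd₂ : 0 < d₂)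
    (hd₃ : 0 < d₃) (hd₄ : 0 < d₄)
    (hFr : ∀ (r : X) (κ : ℝ), ‖fderiv ℝ (fun r' => F (r', κ)) r‖ ≤ d₁)
    (hFk : ∀ (r : X) (κ : ℝ), ‖deriv (fun κ' => F (r, κ')) κ‖ ≤ d₂)
    (hFrr : ∀ (r : X) (κ : ℝ),
      ‖fderiv ℝ (fun r' => fderiv ℝ (fun r'' => F (r'', κ)) r') r‖ ≤ d₃)
    (hFkr : ∀ (r : X) (κ : ℝ),
      ‖deriv (fun κ' => fderiv ℝ (fun r' => F (r', κ')) r) κ‖ ≤ d₄)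
    (X' : Submodule ℝ X) (hX' : IsClosed (X' : Set X))
    (P : X →L[ℝ] X) (hP : ∀ x : X, P x ∈ X' ∧ x - P x ∈ X'ᗮ)
    (k k' : ℝ) (hkk' : k ≤ k')
    (rt rt' : X) (hrtmem : rt ∈ X') (hrt'mem : rt' ∈ X')
    (hrt : F (rt, k) = 0) (hrt' : F (rt', k') = 0)
    (hclose : ‖rt' - rt‖ ≤ d₀ * (k' - k))
    (σ : ℝ) (hσ : 0 ≤ σ)
    (hlow : ∀ x : X, σ * ‖x‖ ≤ ‖fderiv ℝ (fun r' => F (r', k)) rt x‖)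
    (α : ℝ) (hα : 0 < α)
    (r : X) (hrmem : r ∈ X')
    (B : X →L[ℝ] X)
    (hB₁ : B ∘L (α • (1 : X →L[ℝ] X) +
      ContinuousLinearMap.adjoint (fderiv ℝ (fun r' => F (r', k')) r) ∘L
        fderiv ℝ (fun r' => F (r', k')) r) = 1)
    (hB₂ : (α • (1 : X →L[ℝ] X) +
      ContinuousLinearMap.adjoint (fderiv ℝ (fun r' => F (r', k')) r) ∘L
        fderiv ℝ (fun r' => F (r', k')) r) ∘L B = 1)
    (rplus : X)
    (hrplus : rplus = r - P ((B ∘L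
      ContinuousLinearMap.adjoint (fderiv ℝ (fun r' => F (r', k')) r)) (F (r, k')))) :
    ‖rt' - rplus‖ ≤ (k' - k) * (d₀ + d₂ / (2 * Real.sqrt α)) +
      α / (α + σ ^ 2) * ‖rt - r‖ +
      9 * d₁ * d₄ / (4 * α) * (k' - k) * ‖rt - r‖ +
      (9 * d₁ * d₃ / (4 * α) + d₃ / (4 * Real.sqrt α)) * ‖rt - r‖ ^ 2 := by
  have hFd : Differentiable ℝ F := hF.differentiable (by norm_num)
  have hFc : ∀ κ : ℝ, ContDiff ℝ 2 (fun r' : X => F (r', κ)) := fun κ =>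
    hF.comp (contDiff_id.prodMk contDiff_const)
  have hΔ : 0 ≤ k' - k := sub_nonneg.2 hkk'
  set e := rt - r with he
  set A := fderiv ℝ (fun r' => F (r', k')) r with hA
  set A0 := fderiv ℝ (fun r' => F (r', k)) rt with hA0
  have hPn : ∀ x, ‖P x‖ ≤ ‖x‖ := by
    intro x
    have h0 : inner ℝ (P x) (x - P x) = 0 := (hP x).2 _ (hP x).1
    have h1 : ‖x‖ * ‖x‖ = ‖P x‖ * ‖P x‖ + ‖x - P x‖ * ‖x - P x‖ := by
      have := norm_add_sq_eq_norm_sq_add_norm_sq_of_inner_eq_zero (P x) (x - P x) h0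
      simpa using this
    nlinarith [norm_nonneg x, norm_nonneg (P x), mul_self_nonneg ‖x - P x‖]
  have hPf : ∀ x ∈ X', P x = x := by
    intro x hx
    have h0 : inner ℝ (x - P x) (x - P x) = 0 :=
      (hP x).2 _ (X'.sub_mem hx (hP x).1)
    exact (sub_eq_zero.1 (inner_self_eq_zero.1 h0)).symm
  -- bounds
  have hk1 : ‖F (rt, k') - F (rt, k)‖ ≤ d₂ * (k' - k) := by
    have := Convex.norm_image_sub_le_of_norm_deriv_le (𝕜 := ℝ) (s := Set.univ)
      (f := fun κ' => F (rt, κ')) (C := d₂) (x := k) (y := k')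
      (fun x _ => (hFd.comp (by fun_prop : Differentiable ℝ (fun κ : ℝ => (rt, κ)))) x)
      (fun x _ => hFk rt x) convex_univ trivial trivial
    rwa [Real.norm_of_nonneg hΔ] at this
  have hk2 : ‖fderiv ℝ (fun r' => F (r', k')) rt - A0‖ ≤ d₄ * (k' - k) := by
    have hdiff : Differentiable ℝ (fun κ' : ℝ => fderiv ℝ (fun r' => F (r', κ')) rt) := by
      have : ContDiff ℝ 1 (fun κ' : ℝ => fderiv ℝ (fun r' => F (r', κ')) rt) := by
        refine ContDiff.fderiv (n := 1) (m := 2) (f := fun (κ' : ℝ) (r' : X) => F (r', κ')) ?_ contDiff_const (by norm_num)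
        exact hF.comp (contDiff_snd.prodMk contDiff_fst)
      exact this.differentiable (by norm_num)
    have := Convex.norm_image_sub_le_of_norm_deriv_le (𝕜 := ℝ) (s := Set.univ)
      (f := fun κ' : ℝ => fderiv ℝ (fun r' => F (r', κ')) rt) (C := d₄) (x := k) (y := k')
      (fun x _ => hdiff x)
      (fun x _ => hFkr rt x) convex_univ trivial trivial
    rwa [Real.norm_of_nonneg hΔ] at this
  have hk3 : ‖A - fderiv ℝ (fun r' => F (r', k')) rt‖ ≤ d₃ * ‖e‖ := by
    have hd2 : Differentiable ℝ (fun x' => fderiv ℝ (fun r' => F (r', k')) x') :=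
      ((hFc k').fderiv_right (m := 1) (by norm_num)).differentiable (by norm_num)
    have := Convex.norm_image_sub_le_of_norm_fderiv_le (𝕜 := ℝ) (s := Set.univ)
      (f := fun x' => fderiv ℝ (fun r' => F (r', k')) x') (C := d₃) (x := rt) (y := r)
      (fun x _ => hd2 x) (fun x _ => hFrr x k') convex_univ trivial trivial
    rwa [norm_sub_rev r rt] at this
  have hδ : ‖A - A0‖ ≤ d₄ * (k' - k) + d₃ * ‖e‖ := by
    have := norm_sub_le_norm_sub_add_norm_sub A (fderiv ℝ (fun r' => F (r', k')) rt) A0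
    linarith
  have htay := aux_taylor (fun r' => F (r', k')) (hFc k') d₃ (fun x => hFrr x k') r e
  have hre : r + e = rt := by rw [he]; abel
  simp only [hre] at htay
  rw [← hA] at htay
  -- algebra
  have hBr : ∀ x, α • B x + ContinuousLinearMap.adjoint A (A (B x)) = x := fun x => by
    simpa using congrArg (fun T : X →L[ℝ] X => T x) hB₂
  have hBl : ∀ x, B (α • x + ContinuousLinearMap.adjoint A (A x)) = x := fun x => by
    simpa using congrArg (fun T : X →L[ℝ] X => T x) hB₁
  have hR : ∀ y, ‖B (ContinuousLinearMap.adjoint A y)‖ ≤ ‖y‖ / (2 * Real.sqrt α) :=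
    fun y => aux_reg A α hα _ y (hBr _)
  have hu : ‖α • B e‖ ≤ _ := aux_main A A0 α hα (α • B e) e d₁ _ σ hσ hd₁ (hFr _ _) (hFr _ _)
    hδ hlow (by rw [map_smul, map_smul, ← smul_add, hBr])
  have hR1 := hR (F (rt, k') - F (rt, k))
  have hR2 := hR (F (rt, k') - F (r, k') - A e)
  have hs := Real.sqrt_pos.2 hα
  have hdec : rt' - rplus = (rt' - rt) + P (α • B e
      + B (ContinuousLinearMap.adjoint A (F (rt, k') - F (rt, k)))
      - B (ContinuousLinearMap.adjoint A (F (rt, k') - F (r, k') - A e))) := by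
    have h1 : α • B e
      + B (ContinuousLinearMap.adjoint A (F (rt, k') - F (rt, k)))
      - B (ContinuousLinearMap.adjoint A (F (rt, k') - F (r, k') - A e))
      = e + B (ContinuousLinearMap.adjoint A (F (r, k'))) := by
      have h2 := hBl e
      rw [hrt]
      simp only [map_sub, map_add, map_smul, map_zero] at h2 ⊢
      nth_rewrite 3 [← h2]
      abel
    rw [h1, map_add, hPf e (X'.sub_mem hrtmem hrmem), hrplus, he]
    simp only [ContinuousLinearMap.comp_apply]
    abel
  have hfin : ‖rt' - rplus‖ ≤ d₀ * (k' - k) + (‖α • B e‖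
      + (d₂ * (k' - k)) / (2 * Real.sqrt α) + (d₃ / 2 * ‖e‖ ^ 2) / (2 * Real.sqrt α)) := by
    rw [hdec]
    refine (norm_add_le _ _).trans (add_le_add hclose ((hPn _).trans ?_))
    refine (norm_sub_le _ _).trans (add_le_add ((norm_add_le _ _).trans ?_) ?_)
    · refine add_le_add le_rfl (hR1.trans ?_)
      gcongr
    · refine hR2.trans ?_
      gcongr
  refine hfin.trans ((add_le_add le_rfl (add_le_add (add_le_add hu le_rfl) le_rfl)).trans
    (le_of_eq ?_))
  ring
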